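/- arXiv:1903.08021 — 2 statements merged into one kernel-verified Lean document; each statement's English description precedes it below -/
import Mathlib

section
/- Let η be the exponential probability measure e^{-x}1_{x≥0}dx on ℝ and η^n its n-fold product on ℝ^n. Define the cost c(x,y) = Σ_{i=1}^n y_i Λ*_η(x_i/y_i), where Λ*_η(t) = t - 1 - log t for t > 0 and Λ*_η(t) = +∞ for t ≤ 0. If ν is a tilt of η^n, i.e. dν/dη^n = e^{⟨θ,x⟩ - Λ_{η^n}(θ)} for some θ ∈ ℝ^n with θ_i < 1 for all i (where Λ_{η^n}(θ) = log ∫ e^{⟨θ,x⟩} dη^n(x)), then W_c(ν, η^n) = H(ν | η^n). -/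
open MeasureTheory Real Set ENNReal
open scoped Classical

/-- The transportation cost `W_c(ν, μ)`: infimum of `∫ c dπ` over all couplings `π`
of `ν` and `μ`. -/
noncomputable def transportCost {E F : Type*} [MeasurableSpace E] [MeasurableSpace F]
    (c : E → F → ℝ≥0∞) (ν : Measure E) (μ : Measure F) : ℝ≥0∞ :=
  ⨅ (P : Measure (E × F)) (_ : P.map Prod.fst = ν) (_ : P.map Prod.snd = μ),
    ∫⁻ p, c p.1 p.2 ∂P

/-- The relative entropy `H(ν|μ) = ∫ log (dν/dμ) dν` if `ν ≪ μ` (and the integral is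
well defined), and `+∞` otherwise.  (Since the negative part of `log (dν/dμ)` is always
`ν`-integrable for probability measures, non-integrability corresponds to `H = +∞`.) -/

noncomputable def relEntropy {E : Type*} [MeasurableSpace E] (ν μ : Measure E) : ℝ≥0∞ :=
  if ν ≪ μ ∧ Integrable (fun x => Real.log ((ν.rnDeriv μ x).toReal)) ν
  then ENNReal.ofReal (∫ x, Real.log ((ν.rnDeriv μ x).toReal) ∂ν) else ⊤

/-- The exponential probability measure `e^{-x} 1_{x ≥ 0} dx` on `ℝ`. -/
noncomputable def expMeasure : Measure ℝ :=
  volume.withDensity fun x => ENNReal.ofReal (if 0 ≤ x then Real.exp (-x) else 0)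

/-- `Λ*_η(t) = t - 1 - log t` for `t > 0` and `+∞` for `t ≤ 0`. -/
noncomputable def expRate (t : ℝ) : ℝ≥0∞ :=
  if 0 < t then ENNReal.ofReal (t - 1 - Real.log t) else ⊤

/-- The cost `c(x, y) = ∑ i, y i * Λ*_η (x i / y i)`. -/
noncomputable def expCost (n : ℕ) (x y : Fin n → ℝ) : ℝ≥0∞ :=
  ∑ i, ENNReal.ofReal (y i) * expRate (x i / y i)

instance isProbabilityMeasure_expMeasure : IsProbabilityMeasure expMeasure := by
  constructor
  rw [expMeasure, withDensity_apply _ MeasurableSet.univ, Measure.restrict_univ,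
    ← ProbabilityTheory.lintegral_exponentialPDF_eq_one one_pos]
  simp [ProbabilityTheory.exponentialPDF_eq]

lemma measurable_expDensity :
    Measurable fun x : ℝ => ENNReal.ofReal (if 0 ≤ x then Real.exp (-x) else 0) :=
  (Measurable.ite measurableSet_Ici (by fun_prop) measurable_const).ennreal_ofReal

lemma ae_pos_expMeasure : ∀ᵐ x ∂expMeasure, 0 < x := by
  rw [expMeasure, ae_withDensity_iff measurable_expDensity]
  have h : ∀ᵐ x : ℝ, x ≠ 0 := by simp [ae_iff]
  filter_upwards [h] with x hx h
  by_contra hneg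
  exact h (by simp [not_le.2 (lt_of_le_of_ne (not_lt.1 hneg) hx)])

lemma expDensity_mul_eq_indicator (x : ℝ) :
    (ENNReal.ofReal (if 0 ≤ x then Real.exp (-x) else 0)).toReal • x =
      (Ioi (0 : ℝ)).indicator (fun x => Real.exp (-x) * x ^ ((2 : ℝ) - 1)) x := by
  rcases lt_trichotomy x 0 with h | h | h
  · simp [not_le.2 h, not_lt.2 h.le]
  · simp [h]
  · have h1 : (2 : ℝ) - 1 = 1 := by norm_num
    simp [h, h.le, h1, (Real.exp_pos _).le]

lemma integrable_id_expMeasure : Integrable (fun x : ℝ => x) expMeasure := by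
  rw [expMeasure, integrable_withDensity_iff_integrable_smul' measurable_expDensity (by simp)]
  simp_rw [expDensity_mul_eq_indicator]
  rw [integrable_indicator_iff measurableSet_Ioi]
  exact Real.GammaIntegral_convergent two_pos

lemma integral_id_expMeasure : ∫ x, x ∂expMeasure = 1 := by
  rw [expMeasure, integral_withDensity_eq_integral_toReal_smul measurable_expDensity (by simp)]
  simp_rw [expDensity_mul_eq_indicator]
  rw [integral_indicator measurableSet_Ioi, ← Real.Gamma_eq_integral two_pos, Real.Gamma_two]

lemma lintegral_eq_mul_lintegral_comp_mul_left {a : ℝ} (ha : 0 < a) {g : ℝ → ℝ≥0∞}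
    (hg : Measurable g) : ∫⁻ x, g x = ENNReal.ofReal a * ∫⁻ x, g (a * x) := by
  conv_lhs => rw [← Real.smul_map_volume_mul_left ha.ne']
  rw [lintegral_smul_measure, lintegral_map hg (by fun_prop), abs_of_pos ha, smul_eq_mul]

/-- An exponential law rescaled by `a⁻¹` is the tilt of the standard one by `1 - a`. -/
lemma map_div_expMeasure {a : ℝ} (ha : 0 < a) :
    expMeasure.map (fun y => y / a) =
      expMeasure.withDensity fun x => ENNReal.ofReal (a * Real.exp ((1 - a) * x)) := by
  ext s hs
  have hm : Measurable fun x : ℝ => x / a := by fun_prop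
  have hd : Measurable fun x : ℝ => ENNReal.ofReal (a * Real.exp ((1 - a) * x)) := by fun_prop
  rw [Measure.map_apply hm hs, expMeasure, withDensity_apply _ (hm hs),
    ← lintegral_indicator (hm hs),
    lintegral_eq_mul_lintegral_comp_mul_left ha (measurable_expDensity.indicator (hm hs)),
    ← withDensity_mul _ measurable_expDensity hd, withDensity_apply _ hs,
    ← lintegral_indicator hs, ← lintegral_const_mul' _ _ ENNReal.ofReal_ne_top]
  congr 1 with x
  by_cases hx : x ∈ s
  · rw [indicator_of_mem (by simpa [ha.ne'] using hx), indicator_of_mem hx, Pi.mul_apply,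
      ← ENNReal.ofReal_mul ha.le, ← ENNReal.ofReal_mul (by split_ifs <;> positivity)]
    congr 1
    by_cases h0 : 0 ≤ x
    · rw [if_pos (by positivity), if_pos h0, mul_left_comm, ← Real.exp_add]
      ring_nf
    · rw [if_neg (by simpa [ha] using h0), if_neg h0]
      simp
  · rw [indicator_of_notMem (by simpa [ha.ne'] using hx), indicator_of_notMem hx, mul_zero]

lemma lintegral_exp_expMeasure {a : ℝ} (ha : 0 < a) :
    ∫⁻ x, ENNReal.ofReal (Real.exp ((1 - a) * x)) ∂expMeasure = ENNReal.ofReal a⁻¹ := by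
  have h := congrArg (fun m => m univ) (map_div_expMeasure ha)
  simp only [withDensity_apply _ MeasurableSet.univ, Measure.restrict_univ] at h
  rw [Measure.map_apply (by fun_prop) MeasurableSet.univ, preimage_univ, measure_univ] at h
  simp_rw [ENNReal.ofReal_mul ha.le] at h
  rw [lintegral_const_mul' _ _ ENNReal.ofReal_ne_top] at h
  rw [ENNReal.ofReal_inv_of_pos ha]
  exact ENNReal.eq_inv_of_mul_eq_one_left (by rw [mul_comm]; exact h.symm)

lemma integral_exp_expMeasure {t : ℝ} (ht : t < 1) :
    ∫ x, Real.exp (t * x) ∂expMeasure = (1 - t)⁻¹ := by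
  have ha : 0 < 1 - t := sub_pos.2 ht
  rw [integral_eq_lintegral_of_nonneg_ae (ae_of_all _ fun _ => (Real.exp_pos _).le)
    (by fun_prop)]
  have h := lintegral_exp_expMeasure ha
  rw [_root_.sub_sub_cancel] at h
  rw [h, ENNReal.toReal_ofReal (inv_pos.2 ha).le]

lemma lintegral_pi_prod {ι : Type*} [Fintype ι] {X : ι → Type*} [∀ i, MeasurableSpace (X i)]
    (μ : ∀ i, Measure (X i)) [∀ i, IsProbabilityMeasure (μ i)] {f : ∀ i, X i → ℝ≥0∞}
    (hf : ∀ i, Measurable (f i)) :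
    ∫⁻ x, ∏ i, f i (x i) ∂Measure.pi μ = ∏ i, ∫⁻ x, f i x ∂μ i := by
  have hind : ProbabilityTheory.iIndepFun (fun i (x : ∀ i, X i) => f i (x i)) (Measure.pi μ) :=
    ProbabilityTheory.iIndepFun_pi fun i => (hf i).aemeasurable
  have h := ProbabilityTheory.lintegral_prod_eq_prod_lintegral_of_indepFun Finset.univ
    _ hind fun i => (hf i).comp (measurable_pi_apply i)
  rw [h]
  refine Finset.prod_congr rfl fun i _ => ?_
  exact (measurePreserving_eval μ i).lintegral_comp (hf i)

lemma pi_withDensity {ι : Type*} [Fintype ι] {X : ι → Type*} [∀ i, MeasurableSpace (X i)]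
    (μ : ∀ i, Measure (X i)) [∀ i, IsProbabilityMeasure (μ i)] {f : ∀ i, X i → ℝ≥0∞}
    (hf : ∀ i, Measurable (f i)) [∀ i, SigmaFinite ((μ i).withDensity (f i))] :
    Measure.pi (fun i => (μ i).withDensity (f i)) =
      (Measure.pi μ).withDensity fun x => ∏ i, f i (x i) := by
  refine Measure.pi_eq fun s hs => ?_
  have hpi : MeasurableSet (univ.pi s) := MeasurableSet.univ_pi hs
  rw [withDensity_apply _ hpi, ← lintegral_indicator hpi]
  have h : ∀ x : ∀ i, X i, (univ.pi s).indicator (fun x => ∏ i, f i (x i)) x =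
      ∏ i, (s i).indicator (f i) (x i) := fun x => by
    by_cases hx : x ∈ univ.pi s
    · rw [indicator_of_mem hx]
      exact Finset.prod_congr rfl fun i _ => (indicator_of_mem (hx i trivial) _).symm
    · rw [indicator_of_notMem hx]
      obtain ⟨i, hi⟩ : ∃ i, x i ∉ s i := by simpa using hx
      exact (Finset.prod_eq_zero (Finset.mem_univ i) (indicator_of_notMem hi _)).symm
  simp_rw [h]
  rw [lintegral_pi_prod μ fun i => (hf i).indicator (hs i)]
  exact Finset.prod_congr rfl fun i _ => by
    rw [lintegral_indicator (hs i), withDensity_apply _ (hs i)]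

lemma ofReal_integral_le_lintegral_ofReal {α : Type*} [MeasurableSpace α] {μ : Measure α}
    {f : α → ℝ} (hf : Integrable f μ) :
    ENNReal.ofReal (∫ x, f x ∂μ) ≤ ∫⁻ x, ENNReal.ofReal (f x) ∂μ := by
  rw [integral_eq_lintegral_pos_part_sub_lintegral_neg_part hf]
  exact (ENNReal.ofReal_le_ofReal (sub_le_self _ ENNReal.toReal_nonneg)).trans
    ENNReal.ofReal_toReal_le

/-- Fenchel–Young inequality for the exponential law, in perspective form. -/
lemma ofReal_le_mul_expRate {x y t : ℝ} (hy : 0 < y) (ht : t < 1) :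
    ENNReal.ofReal (t * x + y * Real.log (1 - t)) ≤
      ENNReal.ofReal y * expRate (x / y) := by
  unfold expRate
  split_ifs with h
  · rw [← ENNReal.ofReal_mul hy.le]
    apply ENNReal.ofReal_le_ofReal
    have ha : 0 < 1 - t := sub_pos.2 ht
    have h1 := Real.log_le_sub_one_of_pos (mul_pos ha h)
    rw [Real.log_mul ha.ne' h.ne'] at h1
    have h2 : x = y * (x / y) := by field_simp
    have h3 := mul_le_mul_of_nonneg_left h1 hy.le
    calc t * x + y * Real.log (1 - t) = t * (y * (x / y)) + y * Real.log (1 - t) := by rw [← h2]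
      _ ≤ _ := by nlinarith
  · simp [hy]

lemma ofReal_mul_expRate_div {y a : ℝ} (hy : 0 < y) (ha : 0 < a) :
    ENNReal.ofReal y * expRate (y / a / y) =
      ENNReal.ofReal y * ENNReal.ofReal (a⁻¹ - 1 + Real.log a) := by
  have h : y / a / y = a⁻¹ := by field_simp
  rw [h, expRate, if_pos (inv_pos.2 ha), Real.log_inv, sub_neg_eq_add]

lemma inv_sub_one_add_log_nonneg {a : ℝ} (ha : 0 < a) : 0 ≤ a⁻¹ - 1 + Real.log a := by
  have h := Real.log_le_sub_one_of_pos (inv_pos.2 ha)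
  rw [Real.log_inv] at h
  linarith

section Tilt

variable {n : ℕ} {θ : Fin n → ℝ}

lemma log_integral_exp_pi_expMeasure (hθ : ∀ i, θ i < 1) :
    Real.log (∫ x, Real.exp (∑ i, θ i * x i) ∂(Measure.pi fun _ : Fin n => expMeasure)) =
      -∑ i, Real.log (1 - θ i) := by
  simp_rw [Real.exp_sum]
  rw [integral_fintype_prod_eq_prod (fun i (x : ℝ) => Real.exp (θ i * x)),
    Real.log_prod fun i _ => by
      rw [integral_exp_expMeasure (hθ i)]; exact (inv_pos.2 (sub_pos.2 (hθ i))).ne',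
    ← Finset.sum_neg_distrib]
  exact Finset.sum_congr rfl fun i _ => by rw [integral_exp_expMeasure (hθ i), Real.log_inv]

/-- The tilt of the product measure is its image under the coordinatewise rescaling. -/
lemma tilt_eq_map (hθ : ∀ i, θ i < 1) :
    ((Measure.pi fun _ : Fin n => expMeasure).withDensity fun x =>
      ENNReal.ofReal (Real.exp (∑ i, θ i * x i - -∑ i, Real.log (1 - θ i)))) =
    (Measure.pi fun _ : Fin n => expMeasure).map fun y i => y i / (1 - θ i) := by
  have ha : ∀ i, 0 < 1 - θ i := fun i => sub_pos.2 (hθ i)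
  have hs : ∀ i, IsProbabilityMeasure (expMeasure.map fun y : ℝ => y / (1 - θ i)) := fun i =>
    Measure.isProbabilityMeasure_map (by fun_prop)
  rw [Measure.pi_map_pi (f := fun i y => y / (1 - θ i)) fun i => by fun_prop]
  have hs' : ∀ i, IsProbabilityMeasure (expMeasure.withDensity fun x =>
      ENNReal.ofReal ((1 - θ i) * Real.exp ((1 - (1 - θ i)) * x))) := fun i => by
    rw [← map_div_expMeasure (ha i)]; exact hs i
  simp_rw [map_div_expMeasure (ha _)]
  rw [pi_withDensity _ fun i => by fun_prop]
  congr 1 with x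
  rw [← ENNReal.ofReal_prod_of_nonneg fun i _ => mul_nonneg (ha i).le (Real.exp_pos _).le,
    sub_neg_eq_add, ← Finset.sum_add_distrib, Real.exp_sum]
  congr 1
  refine Finset.prod_congr rfl fun i _ => ?_
  rw [Real.exp_add, Real.exp_log (ha i), _root_.sub_sub_cancel, mul_comm]

end Tilt

/-- **Saturation of the exponential transportation-entropy inequality by tilts.**
If `ν` is a tilt of `ηⁿ`, i.e. `dν/dηⁿ = exp(⟨θ, x⟩ - Λ_{ηⁿ}(θ))` with `θ i < 1` for all `i`,
then `W_c(ν, ηⁿ) = H(ν | ηⁿ)`. -/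
theorem exp_transport_entropy_eq_of_tilt (n : ℕ) (θ : Fin n → ℝ) (hθ : ∀ i, θ i < 1)
    (Λθ : ℝ)
    (hΛθ : Λθ = Real.log (∫ x, Real.exp (∑ i, θ i * x i)
      ∂(Measure.pi fun _ : Fin n => expMeasure)))
    (ν : Measure (Fin n → ℝ))
    (hν : ν = (Measure.pi fun _ : Fin n => expMeasure).withDensity
      fun x => ENNReal.ofReal (Real.exp (∑ i, θ i * x i - Λθ))) :
    transportCost (expCost n) ν (Measure.pi fun _ : Fin n => expMeasure) =
      relEntropy ν (Measure.pi fun _ : Fin n => expMeasure) := by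
  rw [log_integral_exp_pi_expMeasure hθ] at hΛθ
  have ha : ∀ i, 0 < 1 - θ i := fun i => sub_pos.2 (hθ i)
  have hmap : ν = (Measure.pi fun _ : Fin n => expMeasure).map fun y i => y i / (1 - θ i) := by
    rw [hν, hΛθ, tilt_eq_map hθ]
  set μ : Measure (Fin n → ℝ) := Measure.pi fun _ : Fin n => expMeasure with hμ
  have hT : Measurable fun (y : Fin n → ℝ) i => y i / (1 - θ i) := by fun_prop
  have : IsProbabilityMeasure ν := hmap ▸ Measure.isProbabilityMeasure_map hT.aemeasurable
  have hμint : ∀ i, Integrable (fun x : Fin n → ℝ => x i) μ := fun i =>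
    integrable_comp_eval (X := fun _ => ℝ) (μ := fun _ => expMeasure) (i := i)
      (f := fun x : ℝ => x) integrable_id_expMeasure
  have hμmean : ∀ i, ∫ x, x i ∂μ = 1 := fun i =>
    (integral_comp_eval (X := fun _ => ℝ) (μ := fun _ => expMeasure) (i := i)
      (f := fun x : ℝ => x) integrable_id_expMeasure.aestronglyMeasurable).trans
      integral_id_expMeasure
  have hμpos : ∀ᵐ y ∂μ, ∀ i, 0 < y i := by
    rw [ae_all_iff]
    exact fun i => (measurePreserving_eval
      (fun _ : Fin n => expMeasure) i).quasiMeasurePreserving.ae ae_pos_expMeasure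
  have hνint : ∀ i, Integrable (fun x : Fin n → ℝ => x i) ν := fun i => by
    rw [hmap, integrable_map_measure (measurable_pi_apply i).aestronglyMeasurable hT.aemeasurable]
    exact (hμint i).div_const _
  have hνmean : ∀ i, ∫ x, x i ∂ν = (1 - θ i)⁻¹ := fun i => by
    rw [hmap, integral_map hT.aemeasurable (measurable_pi_apply i).aestronglyMeasurable,
      integral_div, hμmean, one_div]
  have hterm : ∀ i, θ i * (1 - θ i)⁻¹ + Real.log (1 - θ i) =
      (1 - θ i)⁻¹ - 1 + Real.log (1 - θ i) := fun i => by
    have := (ha i).ne'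
    field_simp
    ring
  have hent : relEntropy ν μ =
      ENNReal.ofReal (∑ i, ((1 - θ i)⁻¹ - 1 + Real.log (1 - θ i))) := by
    have hac : ν ≪ μ := hν ▸ withDensity_absolutelyContinuous _ _
    have hlog : (fun x => Real.log ((ν.rnDeriv μ x).toReal)) =ᵐ[ν]
        fun x => ∑ i, θ i * x i - Λθ := by
      have h : ν.rnDeriv μ =ᵐ[μ]
          fun x => ENNReal.ofReal (Real.exp (∑ i, θ i * x i - Λθ)) := by
        conv_lhs => rw [hν]
        exact Measure.rnDeriv_withDensity μ (by fun_prop)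
      filter_upwards [hac.ae_le h] with x hx
      rw [hx, ENNReal.toReal_ofReal (Real.exp_pos _).le, Real.log_exp]
    have hsum : Integrable (fun x : Fin n → ℝ => ∑ i, θ i * x i) ν :=
      integrable_finsetSum _ fun i _ => (hνint i).const_mul _
    rw [relEntropy, if_pos ⟨hac, (hsum.sub (integrable_const Λθ)).congr hlog.symm⟩,
      integral_congr_ae hlog, integral_sub hsum (integrable_const _),
      integral_finsetSum _ fun i _ => (hνint i).const_mul _]
    simp_rw [integral_const_mul, hνmean]
    rw [integral_const, probReal_univ, one_smul, hΛθ, sub_neg_eq_add, ← Finset.sum_add_distrib]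
    simp_rw [hterm]
  rw [hent]
  apply le_antisymm
  · refine (iInf₂_le (μ.map fun y => (fun i => y i / (1 - θ i), y)) ?_).trans
      ((iInf_le _ ?_).trans ?_)
    · rw [Measure.map_map measurable_fst (by fun_prop)]
      exact hmap.symm
    · rw [Measure.map_map measurable_snd (by fun_prop)]
      exact Measure.map_id
    · refine (lintegral_map_le _ _).trans (le_of_eq ?_)
      have hcost : (fun y : Fin n → ℝ => expCost n (fun i => y i / (1 - θ i)) y) =ᵐ[μ]
          fun y => ENNReal.ofReal (∑ i, y i * ((1 - θ i)⁻¹ - 1 + Real.log (1 - θ i))) := by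
        filter_upwards [hμpos] with y hy
        rw [expCost, ENNReal.ofReal_sum_of_nonneg fun i _ =>
          mul_nonneg (hy i).le (inv_sub_one_add_log_nonneg (ha i))]
        exact Finset.sum_congr rfl fun i _ => by
          rw [ofReal_mul_expRate_div (hy i) (ha i), ENNReal.ofReal_mul (hy i).le]
      rw [lintegral_congr_ae hcost, ← ofReal_integral_eq_lintegral_ofReal
        (integrable_finsetSum _ fun i _ => (hμint i).mul_const _),
        integral_finsetSum _ fun i _ => (hμint i).mul_const _]
      · simp_rw [integral_mul_const, hμmean, one_mul]
      · filter_upwards [hμpos] with y hy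
        exact Finset.sum_nonneg fun i _ =>
          mul_nonneg (hy i).le (inv_sub_one_add_log_nonneg (ha i))
  · refine le_iInf fun P => le_iInf fun h1 => le_iInf fun h2 => ?_
    have hPx : ∀ i, Integrable (fun p : (Fin n → ℝ) × (Fin n → ℝ) => p.1 i) P := fun i => by
      have h := hνint i
      rw [← h1] at h
      exact h.comp_measurable measurable_fst
    have hPy : ∀ i, Integrable (fun p : (Fin n → ℝ) × (Fin n → ℝ) => p.2 i) P := fun i => by
      have h := hμint i
      rw [← h2] at h
      exact h.comp_measurable measurable_snd
    have hEx : ∀ i, ∫ p, p.1 i ∂P = (1 - θ i)⁻¹ := fun i => by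
      rw [← hνmean i, ← h1, integral_map (by fun_prop) (h1 ▸ (hνint i).aestronglyMeasurable)]
    have hEy : ∀ i, ∫ p, p.2 i ∂P = 1 := fun i => by
      rw [← hμmean i, ← h2, integral_map (by fun_prop) (h2 ▸ (hμint i).aestronglyMeasurable)]
    have hterm_int : ∀ i, Integrable (fun p : (Fin n → ℝ) × (Fin n → ℝ) =>
        θ i * p.1 i + p.2 i * Real.log (1 - θ i)) P := fun i =>
      ((hPx i).const_mul _).add ((hPy i).mul_const _)
    have hPpos : ∀ᵐ p ∂P, ∀ i, 0 < p.2 i := by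
      rw [← h2] at hμpos
      exact ae_of_ae_map (by fun_prop) hμpos
    calc ENNReal.ofReal (∑ i, ((1 - θ i)⁻¹ - 1 + Real.log (1 - θ i)))
        = ENNReal.ofReal (∫ p, ∑ i, (θ i * p.1 i + p.2 i * Real.log (1 - θ i)) ∂P) := by
          rw [integral_finsetSum _ fun i _ => hterm_int i]
          congr 1
          refine Finset.sum_congr rfl fun i _ => ?_
          rw [integral_add ((hPx i).const_mul _) ((hPy i).mul_const _), integral_const_mul,
            integral_mul_const, hEx, hEy, one_mul, hterm]
      _ ≤ ∫⁻ p, ENNReal.ofReal (∑ i, (θ i * p.1 i + p.2 i * Real.log (1 - θ i))) ∂P :=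
          ofReal_integral_le_lintegral_ofReal (integrable_finsetSum _ fun i _ => hterm_int i)
      _ ≤ ∫⁻ p, expCost n p.1 p.2 ∂P := by
          refine lintegral_mono_ae ?_
          filter_upwards [hPpos] with p hp
          have hsub : ∀ s : Finset (Fin n),
              ENNReal.ofReal (∑ i ∈ s, (θ i * p.1 i + p.2 i * Real.log (1 - θ i))) ≤
                ∑ i ∈ s, ENNReal.ofReal (θ i * p.1 i + p.2 i * Real.log (1 - θ i)) := fun s =>
            Finset.le_sum_of_subadditive _ ENNReal.ofReal_zero.le
              (fun _ _ => ENNReal.ofReal_add_le) _ _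
          exact (hsub _).trans
            (Finset.sum_le_sum fun i _ => ofReal_le_mul_expRate (hp i) (hθ i))
end

section
/- Let p ∈ (0,1), μ_p = (1-p)δ_{-1} + p δ_1, and let 𝒰 be the uniform probability measure on [-1,1]. Define h_0 = 2p-1, I_p(x) = ((1+x)/2)·log((1+x)/(2p)) + ((1-x)/2)·log((1-x)/(2(1-p))) for x ∈ [-1,1], and the cost w_p(x,u) = Σ_{i=1}^n 2|I_p'(u_i)|·1_{x_i(h_0-u_i)<0} for x ∈ {-1,1}^n, u ∈ [-1,1]^n. If ν is a product probability measure on {-1,1}^n, then equality holds: W_{w_p}(ν, 𝒰^n) = H(ν | μ_p^n). -/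
open MeasureTheory Real Set ENNReal
open scoped Classical

/-- The two-point measure `(1-p) δ_{-1} + p δ_1` on `ℝ`. -/
noncomputable def bernoulliMeasure (p : ℝ) : Measure ℝ :=
  ENNReal.ofReal (1 - p) • Measure.dirac (-1) + ENNReal.ofReal p • Measure.dirac 1

/-- The uniform probability measure on `[-1, 1]`. -/
noncomputable def uniformIcc : Measure ℝ :=
  (2 : ℝ≥0∞)⁻¹ • volume.restrict (Set.Icc (-1 : ℝ) 1)

/-- The cost `w_p(x, u) = ∑ i, 2 |I_p'(u i)| 1_{x i (h₀ - u i) < 0}` with `h₀ = 2p - 1`,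
where `2 |I_p'(u)| = |log ((1+u)(1-p) / ((1-u)p))|` for `u ∈ (-1, 1)`,
and `|I_p'(u)| = +∞` at `u = ± 1` (and outside `[-1,1]`). -/
noncomputable def wCost (p : ℝ) (n : ℕ) (x u : Fin n → ℝ) : ℝ≥0∞ :=
  ∑ i, if x i * ((2 * p - 1) - u i) < 0 then
      (if -1 < u i ∧ u i < 1 then
        ENNReal.ofReal |Real.log ((1 + u i) * (1 - p) / ((1 - u i) * p))| else ⊤)
    else 0

/-- The slope `2 |I_p'(u)|`, equal to `+∞` outside `(-1, 1)`. -/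
noncomputable def logSlope (p u : ℝ) : ℝ≥0∞ :=
  if -1 < u ∧ u < 1 then
    ENNReal.ofReal |Real.log ((1 + u) * (1 - p) / ((1 - u) * p))| else ⊤

/-- The one-dimensional cost, of which `wCost` is the sum over the coordinates. -/
noncomputable def coordCost (p x u : ℝ) : ℝ≥0∞ :=
  if x * ((2 * p - 1) - u) < 0 then logSlope p u else 0

/-- The decreasing transport map from the uniform measure to a two-point measure. -/
noncomputable def threshold (h u : ℝ) : ℝ := if u < h then 1 else -1

/-- The relative entropy of `bernoulliMeasure q` with respect to `bernoulliMeasure p`. -/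
noncomputable def bernoulliKL (p q : ℝ) : ℝ :=
  q * Real.log (q / p) + (1 - q) * Real.log ((1 - q) / (1 - p))

lemma wCost_eq_sum_coordCost (p : ℝ) (n : ℕ) (x u : Fin n → ℝ) :
    wCost p n x u = ∑ i, coordCost p (x i) (u i) := rfl

lemma measurable_logSlope (p : ℝ) : Measurable (logSlope p) := by
  unfold logSlope
  refine Measurable.ite (measurableSet_Ioo (a := (-1 : ℝ)) (b := 1)) ?_ measurable_const
  exact (continuous_abs.measurable.comp (Real.measurable_log.comp (by fun_prop))).ennreal_ofReal

lemma measurable_coordCost (p : ℝ) : Measurable fun z : ℝ × ℝ => coordCost p z.1 z.2 := by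
  unfold coordCost
  refine Measurable.ite ?_ ((measurable_logSlope p).comp measurable_snd) measurable_const
  exact measurableSet_lt (by fun_prop) measurable_const

lemma measurable_threshold (h : ℝ) : Measurable (threshold h) :=
  Measurable.ite measurableSet_Iio measurable_const measurable_const

lemma bernoulliMeasure_apply (q : ℝ) (s : Set ℝ) (hs : MeasurableSet s) :
    bernoulliMeasure q s = ENNReal.ofReal (1 - q) * s.indicator 1 (-1) +
      ENNReal.ofReal q * s.indicator 1 1 := by
  simp [bernoulliMeasure, hs]

lemma lintegral_bernoulliMeasure (q : ℝ) (f : ℝ → ℝ≥0∞) :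
    ∫⁻ x, f x ∂(bernoulliMeasure q) =
      ENNReal.ofReal (1 - q) * f (-1) + ENNReal.ofReal q * f 1 := by
  simp [bernoulliMeasure, lintegral_add_measure]

lemma isProbabilityMeasure_bernoulliMeasure {q : ℝ} (hq : q ∈ Set.Icc (0 : ℝ) 1) :
    IsProbabilityMeasure (bernoulliMeasure q) := by
  constructor
  rw [bernoulliMeasure_apply q _ MeasurableSet.univ]
  simp [← ENNReal.ofReal_add (sub_nonneg.2 hq.2) hq.1]

lemma ae_bernoulliMeasure_iff {q : ℝ} {P : ℝ → Prop} :
    (∀ᵐ x ∂(bernoulliMeasure q), P x) ↔ (q < 1 → P (-1)) ∧ (0 < q → P 1) := by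
  rw [bernoulliMeasure, ae_add_measure_iff]
  refine and_congr ?_ ?_
  · by_cases h : q < 1
    · rw [Measure.ae_ennreal_smul_measure_iff (by simpa using h)]
      simp [ae_dirac_eq, h]
    · simp [ENNReal.ofReal_of_nonpos (sub_nonpos.2 (not_lt.1 h)), h]
  · by_cases h : 0 < q
    · rw [Measure.ae_ennreal_smul_measure_iff (by simpa using h)]
      simp [ae_dirac_eq, h]
    · simp [ENNReal.ofReal_of_nonpos (not_lt.1 h), h]

lemma integrable_bernoulliMeasure (q : ℝ) (f : ℝ → ℝ) : Integrable f (bernoulliMeasure q) := by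
  refine Integrable.add_measure ?_ ?_ <;>
  exact (integrable_dirac (by simp)).smul_measure ENNReal.ofReal_ne_top

lemma integral_bernoulliMeasure {q : ℝ} (hq : q ∈ Set.Icc (0 : ℝ) 1) (f : ℝ → ℝ) :
    ∫ x, f x ∂(bernoulliMeasure q) = (1 - q) * f (-1) + q * f 1 := by
  have h := integrable_bernoulliMeasure q f
  rw [bernoulliMeasure] at h ⊢
  rw [integral_add_measure h.left_of_add_measure h.right_of_add_measure]
  simp [hq.1, hq.2]

lemma uniformIcc_apply (s : Set ℝ) (hs : MeasurableSet s) :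
    uniformIcc s = 2⁻¹ * volume (s ∩ Set.Icc (-1) 1) := by
  simp [uniformIcc, Measure.restrict_apply hs]

instance isProbabilityMeasure_uniformIcc : IsProbabilityMeasure uniformIcc := by
  constructor
  rw [uniformIcc_apply _ MeasurableSet.univ, Set.univ_inter, Real.volume_Icc]
  norm_num
  exact ENNReal.inv_mul_cancel (by simp) (by simp)

lemma uniformIcc_Iio {q : ℝ} (hq : q ∈ Set.Icc (0 : ℝ) 1) :
    uniformIcc (Set.Iio (2 * q - 1)) = ENNReal.ofReal q := by
  have h : Set.Iio (2 * q - 1) ∩ Set.Icc (-1) 1 = Set.Ico (-1) (2 * q - 1) := by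
    ext x
    simp only [Set.mem_inter_iff, Set.mem_Iio, Set.mem_Icc, Set.mem_Ico]
    have := hq.2
    constructor
    · rintro ⟨h1, h2, h3⟩
      exact ⟨h2, h1⟩
    · rintro ⟨h1, h2⟩
      exact ⟨h2, h1, by linarith⟩
  rw [uniformIcc_apply _ measurableSet_Iio, h, Real.volume_Ico,
    show (2 : ℝ≥0∞)⁻¹ = ENNReal.ofReal 2⁻¹ by simp, ← ENNReal.ofReal_mul (by norm_num)]
  congr 1
  ring

lemma map_threshold_uniformIcc {q : ℝ} (hq : q ∈ Set.Icc (0 : ℝ) 1) :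
    uniformIcc.map (threshold (2 * q - 1)) = bernoulliMeasure q := by
  have hI : uniformIcc (Set.Ici (2 * q - 1)) = ENNReal.ofReal (1 - q) := by
    rw [← Set.compl_Iio, prob_compl_eq_one_sub measurableSet_Iio, uniformIcc_Iio hq,
      ENNReal.ofReal_sub _ hq.1, ENNReal.ofReal_one]
  have hpre (h : ℝ) (s : Set ℝ) : uniformIcc (threshold h ⁻¹' s) =
      uniformIcc (Set.Ici h) * s.indicator 1 (-1) + uniformIcc (Set.Iio h) * s.indicator 1 1 := by
    have hset : threshold h ⁻¹' s = {u | u < h ∧ 1 ∈ s ∨ h ≤ u ∧ -1 ∈ s} := by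
      ext u
      by_cases hu : u < h
      · simp [threshold, hu, hu.not_ge]
      · simp [threshold, hu, not_lt.1 hu]
    rw [hset]
    by_cases h1 : (1 : ℝ) ∈ s <;> by_cases h2 : (-1 : ℝ) ∈ s <;> simp [h1, h2]
    · rw [(Set.eq_univ_of_forall fun u => lt_or_ge u h : {u | u < h ∨ h ≤ u} = Set.univ),
        measure_univ, add_comm, ← Set.compl_Iio, prob_add_prob_compl measurableSet_Iio]
    · rfl
    · rfl
  ext s hs
  rw [Measure.map_apply (measurable_threshold _) hs, bernoulliMeasure_apply q s hs,
    ← uniformIcc_Iio hq, ← hI, hpre]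

lemma logSlope_eq {p u : ℝ} (hp : p ∈ Set.Ioo (0 : ℝ) 1) (h1 : -1 < u) (h2 : u < 1) :
    logSlope p u = ENNReal.ofReal
      |Real.log (1 + u) - Real.log (1 - u) - (Real.log p - Real.log (1 - p))| := by
  have h3 : 0 < 1 + u := by linarith
  have h4 : 0 < 1 - u := by linarith
  have h5 : 0 < 1 - p := by linarith [hp.2]
  rw [logSlope, if_pos ⟨h1, h2⟩, Real.log_div (mul_pos h3 h5).ne' (mul_pos h4 hp.1).ne',
    Real.log_mul h3.ne' h5.ne', Real.log_mul h4.ne' hp.1.ne']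
  congr 2
  ring

lemma log_sub_log_le {u v : ℝ} (h1 : -1 < u) (huv : u ≤ v) (h2 : v < 1) :
    Real.log (1 + u) - Real.log (1 - u) ≤ Real.log (1 + v) - Real.log (1 - v) := by
  have := Real.log_le_log (by linarith : 0 < 1 + u) (by linarith : 1 + u ≤ 1 + v)
  have := Real.log_le_log (by linarith : 0 < 1 - v) (by linarith : 1 - v ≤ 1 - u)
  linarith

lemma log_sub_log_two_mul_sub_one {p : ℝ} (hp : p ∈ Set.Ioo (0 : ℝ) 1) :
    Real.log (1 + (2 * p - 1)) - Real.log (1 - (2 * p - 1)) = Real.log p - Real.log (1 - p) := by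
  have h5 : 1 - p ≠ 0 := by linarith [hp.2]
  rw [show 1 + (2 * p - 1) = 2 * p by ring, show 1 - (2 * p - 1) = 2 * (1 - p) by ring,
    Real.log_mul two_ne_zero hp.1.ne', Real.log_mul two_ne_zero h5]
  ring

lemma logSlope_two_mul_sub_one {p : ℝ} (hp : p ∈ Set.Ioo (0 : ℝ) 1) :
    logSlope p (2 * p - 1) = 0 := by
  rw [logSlope_eq hp (by linarith [hp.1]) (by linarith [hp.2]), log_sub_log_two_mul_sub_one hp]
  simp

lemma logSlope_le_of_ge {p u v : ℝ} (hp : p ∈ Set.Ioo (0 : ℝ) 1) (hu : 2 * p - 1 ≤ u)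
    (huv : u ≤ v) : logSlope p u ≤ logSlope p v := by
  by_cases hv : v < 1
  · have h0 := hp.1
    have h1 := log_sub_log_le (by linarith) hu (by linarith)
    have h2 := log_sub_log_le (by linarith) huv hv
    rw [log_sub_log_two_mul_sub_one hp] at h1
    rw [logSlope_eq hp (by linarith) (by linarith), logSlope_eq hp (by linarith) hv,
      abs_of_nonneg (by linarith), abs_of_nonneg (by linarith)]
    exact ENNReal.ofReal_le_ofReal (by linarith)
  · simp [logSlope, hv]

lemma logSlope_le_of_le {p u v : ℝ} (hp : p ∈ Set.Ioo (0 : ℝ) 1) (hu : u ≤ 2 * p - 1)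
    (huv : v ≤ u) : logSlope p u ≤ logSlope p v := by
  by_cases hv : -1 < v
  · have h0 := hp.2
    have h1 := log_sub_log_le (by linarith) hu (by linarith)
    have h2 := log_sub_log_le hv huv (by linarith)
    rw [log_sub_log_two_mul_sub_one hp] at h1
    rw [logSlope_eq hp (by linarith) (by linarith), logSlope_eq hp hv (by linarith),
      abs_of_nonpos (by linarith), abs_of_nonpos (by linarith)]
    exact ENNReal.ofReal_le_ofReal (by linarith)
  · simp [logSlope, hv]

lemma coordCost_one (p u : ℝ) :
    coordCost p 1 u = if 2 * p - 1 < u then logSlope p u else 0 := by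
  simp [coordCost]

lemma coordCost_neg_one (p u : ℝ) :
    coordCost p (-1) u = if u < 2 * p - 1 then logSlope p u else 0 := by
  simp [coordCost]

/-- Complementary slackness: adding to the cost a price `logSlope p h` for the atom `s`
makes the transport map `threshold h` pointwise optimal. -/
lemma coordCost_threshold_add_le {p h s : ℝ} (hp : p ∈ Set.Ioo (0 : ℝ) 1)
    (hs : s = -1 ∧ 2 * p - 1 ≤ h ∨ s = 1 ∧ h ≤ 2 * p - 1) {x : ℝ} (hx : x = -1 ∨ x = 1) (u : ℝ) :
    coordCost p (threshold h u) u + ({s} : Set ℝ).indicator (fun _ => logSlope p h)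
        (threshold h u) ≤
      coordCost p x u + ({s} : Set ℝ).indicator (fun _ => logSlope p h) x := by
  have h0 := logSlope_two_mul_sub_one hp
  have hne : (1 : ℝ) ≠ -1 := by norm_num
  have hne' : (-1 : ℝ) ≠ 1 := by norm_num
  rcases hs with ⟨rfl, hh⟩ | ⟨rfl, hh⟩ <;> by_cases hu : u < h <;> rcases hx with rfl | rfl <;>
    simp only [threshold, hu, if_true, if_false, coordCost_one, coordCost_neg_one,
      Set.indicator_of_mem, Set.mem_singleton_iff, Set.indicator_of_notMem, hne, hne',
      not_false_eq_true, add_zero, le_refl]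
  · split_ifs with h1 h2 h2
    · linarith
    · simpa using logSlope_le_of_ge hp h1.le hu.le
    · simp
    · simp
  · rw [if_neg (by linarith), zero_add]
    split_ifs with h1
    · exact logSlope_le_of_ge hp hh (not_lt.1 hu)
    · rw [show h = 2 * p - 1 by linarith, h0]
  · rw [if_neg (by linarith), if_pos (by linarith), zero_add]
    exact logSlope_le_of_le hp (by linarith) hu.le
  · split_ifs with h1 h2 h2
    · linarith
    · simpa using logSlope_le_of_le hp h1.le (not_lt.1 hu)
    · simp
    · simp

lemma logSlope_mul_bernoulliMeasure_ne_top {p q s : ℝ} (hp : p ∈ Set.Ioo (0 : ℝ) 1)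
    (hq : q ∈ Set.Icc (0 : ℝ) 1)
    (hs : s = -1 ∧ p ≤ q ∨ s = 1 ∧ q ≤ p) :
    logSlope p (2 * q - 1) * bernoulliMeasure q {s} ≠ ⊤ := by
  have hne : (1 : ℝ) ≠ -1 := by norm_num
  have hne' : (-1 : ℝ) ≠ 1 := by norm_num
  obtain ⟨h0, h1⟩ := hp
  obtain ⟨h2, h3⟩ := hq
  rw [bernoulliMeasure_apply q _ (measurableSet_singleton s)]
  rcases hs with ⟨rfl, hh⟩ | ⟨rfl, hh⟩
  · rcases h3.eq_or_lt with rfl | h3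
    · simp [hne]
    · simp only [logSlope]
      rw [if_pos ⟨by linarith, by linarith⟩]
      simp [hne, ENNReal.mul_eq_top]
  · rcases h2.eq_or_lt with rfl | h2
    · simp [hne']
    · simp only [logSlope]
      rw [if_pos ⟨by linarith, by linarith⟩]
      simp [hne', ENNReal.mul_eq_top]

/-- The map `threshold (2 * q - 1)` is an optimal transport from `uniformIcc` to
`bernoulliMeasure q` for the cost `coordCost p`. -/
lemma lintegral_coordCost_threshold_le {Ω : Type*} [MeasurableSpace Ω] {P : Measure Ω}
    {X U : Ω → ℝ} (hX : Measurable X) (hU : Measurable U) {p q : ℝ}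
    (hp : p ∈ Set.Ioo (0 : ℝ) 1) (hq : q ∈ Set.Icc (0 : ℝ) 1)
    (hPX : P.map X = bernoulliMeasure q) (hPU : P.map U = uniformIcc) :
    ∫⁻ u, coordCost p (threshold (2 * q - 1) u) u ∂uniformIcc ≤
      ∫⁻ ω, coordCost p (X ω) (U ω) ∂P := by
  obtain ⟨s, hs⟩ : ∃ s : ℝ, s = -1 ∧ p ≤ q ∨ s = 1 ∧ q ≤ p := by
    rcases le_total p q with h | h
    · exact ⟨-1, Or.inl ⟨rfl, h⟩⟩
    · exact ⟨1, Or.inr ⟨rfl, h⟩⟩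
  have hs' : s = -1 ∧ 2 * p - 1 ≤ 2 * q - 1 ∨ s = 1 ∧ 2 * q - 1 ≤ 2 * p - 1 := by
    simpa using hs
  set M := logSlope p (2 * q - 1) with hM
  set T := threshold (2 * q - 1) with hT
  have hTm : Measurable T := measurable_threshold _
  have hg : Measurable (({s} : Set ℝ).indicator fun _ => M) :=
    measurable_const.indicator (measurableSet_singleton s)
  have hprice : ∫⁻ y, ({s} : Set ℝ).indicator (fun _ => M) y ∂(bernoulliMeasure q) =
      M * bernoulliMeasure q {s} := by
    rw [lintegral_indicator (measurableSet_singleton s), setLIntegral_const]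
  have h1 : ∫⁻ u, ({s} : Set ℝ).indicator (fun _ => M) (T u) ∂uniformIcc =
      M * bernoulliMeasure q {s} := by
    rw [← hprice, ← map_threshold_uniformIcc hq, lintegral_map hg hTm]
  have h2 : ∫⁻ ω, ({s} : Set ℝ).indicator (fun _ => M) (X ω) ∂P =
      M * bernoulliMeasure q {s} := by
    rw [← hprice, ← hPX, lintegral_map hg hX]
  have hXae : ∀ᵐ ω ∂P, X ω = -1 ∨ X ω = 1 := by
    refine ae_of_ae_map hX.aemeasurable (p := fun x => x = -1 ∨ x = 1) ?_
    rw [hPX, ae_bernoulliMeasure_iff]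
    simp
  have hcT : Measurable fun u => coordCost p (T u) u :=
    (measurable_coordCost p).comp (hTm.prodMk measurable_id)
  refine (ENNReal.add_le_add_iff_right
    (logSlope_mul_bernoulliMeasure_ne_top hp hq hs)).1 ?_
  calc _ = ∫⁻ u, (coordCost p (T u) u + ({s} : Set ℝ).indicator (fun _ => M) (T u)) ∂uniformIcc := by
        rw [lintegral_add_left hcT, h1]
    _ = ∫⁻ ω, (coordCost p (T (U ω)) (U ω) +
          ({s} : Set ℝ).indicator (fun _ => M) (T (U ω))) ∂P := by
        rw [← hPU]
        exact lintegral_map (hcT.add (hg.comp hTm)) hU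
    _ ≤ ∫⁻ ω, (coordCost p (X ω) (U ω) + ({s} : Set ℝ).indicator (fun _ => M) (X ω)) ∂P :=
        lintegral_mono_ae (hXae.mono fun ω hω => coordCost_threshold_add_le hp hs' hω (U ω))
    _ = _ := by
        rw [lintegral_add_right (g := fun ω => ({s} : Set ℝ).indicator (fun _ => M) (X ω)) _
          (hg.comp hX), h2]

lemma lintegral_ofReal_deriv_Ioo {G g : ℝ → ℝ} {a b : ℝ} (hab : a ≤ b)
    (hG : ContinuousOn G (Set.Icc a b)) (hderiv : ∀ x ∈ Set.Ioo a b, HasDerivAt G (g x) x)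
    (hg : ∀ x ∈ Set.Ioo a b, 0 ≤ g x) :
    0 ≤ G b - G a ∧
      ∫⁻ x in Set.Ioo a b, ENNReal.ofReal (g x) = ENNReal.ofReal (G b - G a) := by
  have hint : IntegrableOn g (Set.Ioc a b) :=
    intervalIntegral.integrableOn_deriv_of_nonneg hG hderiv hg
  have hftc := intervalIntegral.integral_eq_sub_of_hasDerivAt_of_le hab hG hderiv
    ((intervalIntegrable_iff_integrableOn_Ioc_of_le hab).2 hint)
  rw [intervalIntegral.integral_of_le hab, integral_Ioc_eq_integral_Ioo] at hftc
  have hnn : 0 ≤ᵐ[volume.restrict (Set.Ioo a b)] g :=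
    (ae_restrict_mem measurableSet_Ioo).mono hg
  rw [← hftc]
  exact ⟨integral_nonneg_of_ae hnn,
    (ofReal_integral_eq_lintegral_ofReal (hint.mono_set Set.Ioo_subset_Ioc_self) hnn).symm⟩

lemma lintegral_uniformIcc_indicator_Ioo {a b : ℝ} (ha : -1 ≤ a) (hb : b ≤ 1) (f : ℝ → ℝ≥0∞) :
    ∫⁻ u, (Set.Ioo a b).indicator f u ∂uniformIcc = 2⁻¹ * ∫⁻ u in Set.Ioo a b, f u := by
  rw [uniformIcc, lintegral_smul_measure, lintegral_indicator measurableSet_Ioo,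
    Measure.restrict_restrict measurableSet_Ioo, Set.inter_eq_left.2]
  · rfl
  · exact fun x hx => ⟨ha.trans hx.1.le, hx.2.le.trans hb⟩

/-- The primitive `2 I_p` of the slope, up to the additive normalisation. -/
noncomputable def slopePrimitive (p u : ℝ) : ℝ :=
  (1 + u) * Real.log (1 + u) + (1 - u) * Real.log (1 - u)
    - (Real.log p - Real.log (1 - p)) * u

lemma continuous_slopePrimitive (p : ℝ) : Continuous (slopePrimitive p) := by
  unfold slopePrimitive
  refine ((Real.continuous_mul_log.comp (by fun_prop : Continuous fun u : ℝ => 1 + u)).add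
    (Real.continuous_mul_log.comp (by fun_prop : Continuous fun u : ℝ => 1 - u))).sub
    (by fun_prop)

lemma hasDerivAt_slopePrimitive (p : ℝ) {u : ℝ} (h1 : -1 < u) (h2 : u < 1) :
    HasDerivAt (slopePrimitive p)
      (Real.log (1 + u) - Real.log (1 - u) - (Real.log p - Real.log (1 - p))) u := by
  have e1 := (Real.hasDerivAt_mul_log (by linarith : 1 + u ≠ 0)).comp u
    ((hasDerivAt_id u).const_add 1)
  have e2 := (Real.hasDerivAt_mul_log (by linarith : 1 - u ≠ 0)).comp u
    ((hasDerivAt_id u).const_sub 1)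
  convert! (e1.add e2).sub ((hasDerivAt_id u).const_mul (Real.log p - Real.log (1 - p))) using 1
  ring

lemma slopePrimitive_sub {p q : ℝ} (hp : p ∈ Set.Ioo (0 : ℝ) 1) :
    slopePrimitive p (2 * q - 1) - slopePrimitive p (2 * p - 1) = 2 * bernoulliKL p q := by
  have hp' : 1 - p ≠ 0 := by linarith [hp.2]
  have key : ∀ a b : ℝ, b ≠ 0 → 2 * a * Real.log (2 * a) =
      2 * a * Real.log 2 + 2 * (a * Real.log (a / b)) + 2 * a * Real.log b := by
    intro a b hb
    rcases eq_or_ne a 0 with rfl | ha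
    · simp
    · rw [Real.log_mul two_ne_zero ha, Real.log_div ha hb]
      ring
  have e1 := key q p hp.1.ne'
  have e2 := key (1 - q) (1 - p) hp'
  have e3 := key p p hp.1.ne'
  have e4 := key (1 - p) (1 - p) hp'
  rw [div_self hp.1.ne', Real.log_one] at e3
  rw [div_self hp', Real.log_one] at e4
  simp only [slopePrimitive, bernoulliKL]
  rw [show 1 + (2 * p - 1) = 2 * p by ring, show 1 - (2 * p - 1) = 2 * (1 - p) by ring,
    show 1 + (2 * q - 1) = 2 * q by ring, show 1 - (2 * q - 1) = 2 * (1 - q) by ring,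
    e1, e2, e3, e4]
  ring

lemma inv_two_mul_ofReal_two_mul (x : ℝ) :
    (2 : ℝ≥0∞)⁻¹ * ENNReal.ofReal (2 * x) = ENNReal.ofReal x := by
  rw [ENNReal.ofReal_mul zero_le_two, ← mul_assoc, ENNReal.ofReal_ofNat,
    ENNReal.inv_mul_cancel two_ne_zero ENNReal.ofNat_ne_top, one_mul]

lemma lintegral_coordCost_threshold {p q : ℝ} (hp : p ∈ Set.Ioo (0 : ℝ) 1)
    (hq : q ∈ Set.Icc (0 : ℝ) 1) :
    0 ≤ bernoulliKL p q ∧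
      ∫⁻ u, coordCost p (threshold (2 * q - 1) u) u ∂uniformIcc =
        ENNReal.ofReal (bernoulliKL p q) := by
  have hG := continuous_slopePrimitive p
  have hsub := slopePrimitive_sub (q := q) hp
  obtain ⟨hp0, hp1⟩ := id hp
  obtain ⟨hq0, hq1⟩ := hq
  have hlog := log_sub_log_two_mul_sub_one hp
  rcases le_total p q with hpq | hpq
  · have hnn : ∀ x ∈ Set.Ioo (2 * p - 1) (2 * q - 1),
        0 ≤ Real.log (1 + x) - Real.log (1 - x) - (Real.log p - Real.log (1 - p)) := by
      intro x hx
      have := log_sub_log_le (by linarith) hx.1.le (by linarith [hx.2])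
      linarith
    obtain ⟨h1, h2⟩ := lintegral_ofReal_deriv_Ioo (by linarith) hG.continuousOn
      (fun x hx => hasDerivAt_slopePrimitive p (by linarith [hx.1]) (by linarith [hx.2])) hnn
    refine ⟨by linarith, ?_⟩
    have hc : (fun u => coordCost p (threshold (2 * q - 1) u) u) =
        (Set.Ioo (2 * p - 1) (2 * q - 1)).indicator (logSlope p) := by
      ext u
      by_cases hu : u < 2 * q - 1
      · simp [threshold, hu, coordCost_one, Set.indicator_apply]
      · have : ¬ u < 2 * p - 1 := by linarith
        simp [threshold, hu, coordCost_neg_one, this]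
    rw [hc, lintegral_uniformIcc_indicator_Ioo (by linarith) (by linarith),
      ← inv_two_mul_ofReal_two_mul, ← hsub, ← h2]
    congr 1
    refine setLIntegral_congr_fun measurableSet_Ioo fun x hx => ?_
    rw [logSlope_eq hp (by linarith [hx.1]) (by linarith [hx.2]), abs_of_nonneg (hnn x hx)]
  · have hnn : ∀ x ∈ Set.Ioo (2 * q - 1) (2 * p - 1),
        0 ≤ -(Real.log (1 + x) - Real.log (1 - x) - (Real.log p - Real.log (1 - p))) := by
      intro x hx
      have := log_sub_log_le (by linarith [hx.1]) hx.2.le (by linarith)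
      linarith
    obtain ⟨h1, h2⟩ := lintegral_ofReal_deriv_Ioo (by linarith) hG.neg.continuousOn
      (fun x hx => (hasDerivAt_slopePrimitive p (by linarith [hx.1]) (by linarith [hx.2])).neg) hnn
    simp only [Pi.neg_apply] at h1 h2
    rw [show -slopePrimitive p (2 * p - 1) - -slopePrimitive p (2 * q - 1) =
      2 * bernoulliKL p q by linarith] at h1 h2
    refine ⟨by linarith, ?_⟩
    have hc : (fun u => coordCost p (threshold (2 * q - 1) u) u) =ᵐ[uniformIcc]
        (Set.Ioo (2 * q - 1) (2 * p - 1)).indicator (logSlope p) := by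
      have hae : ∀ᵐ u ∂uniformIcc, u ≠ 2 * q - 1 :=
        Measure.ae_smul_measure (ae_restrict_of_ae (Measure.ae_ne volume _)) _
      filter_upwards [hae] with u hne
      by_cases hu : u < 2 * q - 1
      · have : ¬ 2 * p - 1 < u := by linarith
        simp [threshold, hu, coordCost_one, this, hu.le]
      · have : 2 * q - 1 < u := lt_of_le_of_ne (not_lt.1 hu) hne.symm
        simp [threshold, hu, coordCost_neg_one, this, Set.indicator_apply]
    rw [lintegral_congr_ae hc, lintegral_uniformIcc_indicator_Ioo (by linarith) (by linarith),
      ← inv_two_mul_ofReal_two_mul, ← h2]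
    congr 1
    refine setLIntegral_congr_fun measurableSet_Ioo fun x hx => ?_
    rw [logSlope_eq hp (by linarith [hx.1]) (by linarith [hx.2]), ← abs_neg,
      abs_of_nonneg (hnn x hx)]

/-- The transportation cost between products is the sum of the one-dimensional costs. -/
lemma transportCost_wCost_pi {p : ℝ} (hp : p ∈ Set.Ioo (0 : ℝ) 1) (n : ℕ) (q : Fin n → ℝ)
    (hq : ∀ i, q i ∈ Set.Icc (0 : ℝ) 1) :
    transportCost (wCost p n) (Measure.pi fun i => bernoulliMeasure (q i))
        (Measure.pi fun _ : Fin n => uniformIcc) =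
      ∑ i, ENNReal.ofReal (bernoulliKL p (q i)) := by
  have := fun i => isProbabilityMeasure_bernoulliMeasure (hq i)
  have hval := fun i => (lintegral_coordCost_threshold hp (hq i)).2
  have hm := measurable_coordCost p
  have hX (i : Fin n) : Measurable fun z : (Fin n → ℝ) × (Fin n → ℝ) => z.1 i :=
    (measurable_pi_apply i).comp measurable_fst
  have hU (i : Fin n) : Measurable fun z : (Fin n → ℝ) × (Fin n → ℝ) => z.2 i :=
    (measurable_pi_apply i).comp measurable_snd
  have hcost (i : Fin n) : Measurable fun z : (Fin n → ℝ) × (Fin n → ℝ) =>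
      coordCost p (z.1 i) (z.2 i) := hm.comp ((hX i).prodMk (hU i))
  apply le_antisymm
  · let T : (Fin n → ℝ) → Fin n → ℝ := fun u i => threshold (2 * q i - 1) (u i)
    have hT : Measurable T :=
      measurable_pi_lambda _ fun i => (measurable_threshold _).comp (measurable_pi_apply i)
    let P := (Measure.pi fun _ : Fin n => uniformIcc).map fun u => (T u, u)
    have hTm : Measurable fun u => (T u, u) := hT.prodMk measurable_id
    have hfst : P.map Prod.fst = Measure.pi fun i => bernoulliMeasure (q i) := by
      rw [Measure.map_map measurable_fst hTm]
      simp_rw [← map_threshold_uniformIcc (hq _)]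
      exact Measure.pi_map_pi fun i => (measurable_threshold _).aemeasurable
    have hsnd : P.map Prod.snd = Measure.pi fun _ : Fin n => uniformIcc := by
      rw [Measure.map_map measurable_snd hTm]
      exact Measure.map_id
    refine (iInf_le_of_le P (iInf_le_of_le hfst (iInf_le _ hsnd))).trans_eq ?_
    simp_rw [wCost_eq_sum_coordCost]
    rw [lintegral_map ?_ hTm, lintegral_finsetSum]
    · refine Finset.sum_congr rfl fun i _ => ?_
      rw [← hval i]
      exact (measurePreserving_eval (fun _ : Fin n => uniformIcc) i).lintegral_comp
        (hm.comp ((measurable_threshold (2 * q i - 1)).prodMk measurable_id))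
    · exact fun i _ => hm.comp ((((measurable_pi_apply i).comp hT)).prodMk (measurable_pi_apply i))
    · exact Finset.measurable_sum _ fun i _ => hcost i
  · refine le_iInf fun P => le_iInf fun hfst => le_iInf fun hsnd => ?_
    simp_rw [wCost_eq_sum_coordCost]
    rw [lintegral_finsetSum _ fun i _ => hcost i]
    refine Finset.sum_le_sum fun i _ => ?_
    rw [← hval i]
    refine lintegral_coordCost_threshold_le (hX i) (hU i) hp (hq i) ?_ ?_
    · rw [← (measurePreserving_eval (fun i => bernoulliMeasure (q i)) i).map_eq, ← hfst,
        Measure.map_map (measurable_pi_apply i) measurable_fst]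
      rfl
    · rw [← (measurePreserving_eval (fun _ : Fin n => uniformIcc) i).map_eq, ← hsnd,
        Measure.map_map (measurable_pi_apply i) measurable_snd]
      rfl

lemma pi_withDensity_prod {n : ℕ} (μ : Fin n → Measure ℝ) [∀ i, IsProbabilityMeasure (μ i)]
    (f : Fin n → ℝ → ℝ≥0∞) (hf : ∀ i, Measurable (f i))
    [∀ i, SigmaFinite ((μ i).withDensity (f i))] :
    Measure.pi (fun i => (μ i).withDensity (f i)) =
      (Measure.pi μ).withDensity fun x => ∏ i, f i (x i) := by
  refine Measure.pi_eq fun s hs => ?_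
  have hind : (fun x : Fin n → ℝ => (Set.univ.pi s).indicator (fun x => ∏ i, f i (x i)) x) =
      fun x => ∏ i, (s i).indicator (f i) (x i) := by
    ext x
    by_cases hx : x ∈ Set.univ.pi s
    · rw [Set.indicator_of_mem hx]
      exact Finset.prod_congr rfl fun i _ => (Set.indicator_of_mem (hx i trivial) _).symm
    · rw [Set.indicator_of_notMem hx]
      obtain ⟨i, hi⟩ : ∃ i, x i ∉ s i := by simpa using hx
      exact (Finset.prod_eq_zero (Finset.mem_univ i) (Set.indicator_of_notMem hi _)).symm
  have hm : ∀ i, Measurable ((s i).indicator (f i)) := fun i => (hf i).indicator (hs i)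
  rw [withDensity_apply _ (MeasurableSet.univ_pi hs),
    ← lintegral_indicator (MeasurableSet.univ_pi hs), hind]
  have hindep := ProbabilityTheory.iIndepFun_pi (μ := μ)
    (X := fun i => (s i).indicator (f i)) fun i => (hm i).aemeasurable
  have hprod := ProbabilityTheory.lintegral_prod_eq_prod_lintegral_of_indepFun Finset.univ
    _ hindep fun i => (hm i).comp (measurable_pi_apply i)
  rw [hprod]
  refine Finset.prod_congr rfl fun i _ => ?_
  rw [withDensity_apply _ (hs i), ← lintegral_indicator (hs i)]
  exact (measurePreserving_eval μ i).lintegral_comp (hm i)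

/-- The density of `bernoulliMeasure q` with respect to `bernoulliMeasure p`. -/
noncomputable def bernoulliDensity (p q x : ℝ) : ℝ :=
  if x = 1 then q / p else (1 - q) / (1 - p)

lemma measurable_bernoulliDensity (p q : ℝ) : Measurable (bernoulliDensity p q) :=
  Measurable.ite (measurableSet_singleton 1) measurable_const measurable_const

lemma bernoulliDensity_nonneg {p q : ℝ} (hp : p ∈ Set.Ioo (0 : ℝ) 1)
    (hq : q ∈ Set.Icc (0 : ℝ) 1) (x : ℝ) : 0 ≤ bernoulliDensity p q x := by
  unfold bernoulliDensity
  split_ifs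
  · exact div_nonneg hq.1 hp.1.le
  · exact div_nonneg (sub_nonneg.2 hq.2) (sub_nonneg.2 hp.2.le)

lemma bernoulliMeasure_eq_withDensity {p q : ℝ} (hp : p ∈ Set.Ioo (0 : ℝ) 1) :
    bernoulliMeasure q =
      (bernoulliMeasure p).withDensity fun x => ENNReal.ofReal (bernoulliDensity p q x) := by
  have hne' : (-1 : ℝ) ≠ 1 := by norm_num
  have hp' : 0 < 1 - p := by linarith [hp.2]
  ext s hs
  rw [withDensity_apply _ hs, ← lintegral_indicator hs, lintegral_bernoulliMeasure,
    bernoulliMeasure_apply q s hs]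
  have e1 : ENNReal.ofReal p * ENNReal.ofReal (q / p) = ENNReal.ofReal q := by
    rw [← ENNReal.ofReal_mul hp.1.le, mul_div_cancel₀ _ hp.1.ne']
  have e2 : ENNReal.ofReal (1 - p) * ENNReal.ofReal ((1 - q) / (1 - p)) =
      ENNReal.ofReal (1 - q) := by
    rw [← ENNReal.ofReal_mul hp'.le, mul_div_cancel₀ _ hp'.ne']
  by_cases h1 : (1 : ℝ) ∈ s <;> by_cases h2 : (-1 : ℝ) ∈ s <;>
    simp [h1, h2, bernoulliDensity, hne', e1, e2]

lemma relEntropy_pi_bernoulliMeasure {p : ℝ} (hp : p ∈ Set.Ioo (0 : ℝ) 1) (n : ℕ)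
    (q : Fin n → ℝ) (hq : ∀ i, q i ∈ Set.Icc (0 : ℝ) 1) :
    relEntropy (Measure.pi fun i => bernoulliMeasure (q i))
        (Measure.pi fun _ : Fin n => bernoulliMeasure p) =
      ENNReal.ofReal (∑ i, bernoulliKL p (q i)) := by
  have := fun i => isProbabilityMeasure_bernoulliMeasure (hq i)
  have := isProbabilityMeasure_bernoulliMeasure (Set.Ioo_subset_Icc_self hp)
  set ν := Measure.pi fun i => bernoulliMeasure (q i) with hν
  set μ := Measure.pi fun _ : Fin n => bernoulliMeasure p with hμ
  have hmeas : ∀ i, Measurable fun x => ENNReal.ofReal (bernoulliDensity p (q i) x) :=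
    fun i => (measurable_bernoulliDensity p (q i)).ennreal_ofReal
  have hdens : ν = μ.withDensity
      fun x => ∏ i, ENNReal.ofReal (bernoulliDensity p (q i) (x i)) := by
    have : ∀ i, SigmaFinite ((bernoulliMeasure p).withDensity
        fun x => ENNReal.ofReal (bernoulliDensity p (q i) x)) := fun i => by
      rw [← bernoulliMeasure_eq_withDensity hp]
      infer_instance
    rw [hμ, ← pi_withDensity_prod (fun _ => bernoulliMeasure p) _ hmeas, hν]
    congr 1
    ext1 i
    exact bernoulliMeasure_eq_withDensity hp
  have hac : ν ≪ μ := by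
    rw [hdens]
    exact withDensity_absolutelyContinuous _ _
  have hrn : ν.rnDeriv μ =ᵐ[ν] fun x => ∏ i, ENNReal.ofReal (bernoulliDensity p (q i) (x i)) := by
    refine hac.ae_eq ?_
    rw [hdens]
    exact Measure.rnDeriv_withDensity μ
      (Finset.measurable_prod _ fun i _ => (hmeas i).comp (measurable_pi_apply i))
  have hpos : ∀ᵐ x ∂ν, ∀ i, bernoulliDensity p (q i) (x i) ≠ 0 := by
    refine ae_all_iff.2 fun i => ?_
    refine (measurePreserving_eval (fun i => bernoulliMeasure (q i)) i).quasiMeasurePreserving.ae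
      (p := fun y => bernoulliDensity p (q i) y ≠ 0) ?_
    rw [ae_bernoulliMeasure_iff]
    have hne' : (-1 : ℝ) ≠ 1 := by norm_num
    have hp' : 1 - p ≠ 0 := by linarith [hp.2]
    simp only [bernoulliDensity, hne', if_true, if_false]
    exact ⟨fun h => div_ne_zero (by linarith) hp', fun h => div_ne_zero h.ne' hp.1.ne'⟩
  have hlog : (fun x => Real.log ((ν.rnDeriv μ x).toReal)) =ᵐ[ν]
      fun x => ∑ i, Real.log (bernoulliDensity p (q i) (x i)) := by
    filter_upwards [hrn, hpos] with x hx hx'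
    rw [hx, ENNReal.toReal_prod]
    simp_rw [ENNReal.toReal_ofReal (bernoulliDensity_nonneg hp (hq _) _)]
    exact Real.log_prod fun i _ => hx' i
  have hint : ∀ i, Integrable (fun x : Fin n → ℝ => Real.log (bernoulliDensity p (q i) (x i))) ν :=
    fun i => integrable_comp_eval (μ := fun i => bernoulliMeasure (q i))
      (f := fun y => Real.log (bernoulliDensity p (q i) y)) (integrable_bernoulliMeasure _ _)
  have hsum : ∫ x, Real.log ((ν.rnDeriv μ x).toReal) ∂ν = ∑ i, bernoulliKL p (q i) := by
    rw [integral_congr_ae hlog, integral_finsetSum _ fun i _ => hint i]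
    refine Finset.sum_congr rfl fun i _ => ?_
    have hne' : (-1 : ℝ) ≠ 1 := by norm_num
    rw [hν, integral_comp_eval (μ := fun i => bernoulliMeasure (q i))
      (f := fun y => Real.log (bernoulliDensity p (q i) y))
      (integrable_bernoulliMeasure _ _).aestronglyMeasurable, integral_bernoulliMeasure (hq i)]
    simp only [bernoulliDensity, hne', if_true, if_false, bernoulliKL]
    ring
  rw [relEntropy, if_pos ⟨hac, (integrable_congr hlog).2 (integrable_finsetSum _ fun i _ => hint i)⟩,
    hsum]

/-- **Saturation by product measures.** If `ν` is a product probability measure on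
`{-1,1}ⁿ`, then `W_{w_p}(ν, 𝒰ⁿ) = H(ν | μ_pⁿ)`. -/
theorem bernoulli_transport_entropy_eq_of_prod (p : ℝ) (hp : p ∈ Set.Ioo (0 : ℝ) 1) (n : ℕ)
    (q : Fin n → ℝ) (hq : ∀ i, q i ∈ Set.Icc (0 : ℝ) 1) :
    transportCost (wCost p n) (Measure.pi fun i => bernoulliMeasure (q i))
        (Measure.pi fun _ : Fin n => uniformIcc) =
      relEntropy (Measure.pi fun i => bernoulliMeasure (q i))
        (Measure.pi fun _ : Fin n => bernoulliMeasure p) := by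
  rw [transportCost_wCost_pi hp n q hq, relEntropy_pi_bernoulliMeasure hp n q hq,
    ENNReal.ofReal_sum_of_nonneg fun i _ => (lintegral_coordCost_threshold hp (hq i)).1]
end
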